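/- The fixed point sequence satisfies m_n √(2n) → 1 as n → ∞, i.e. m_n ∼ 1/√(2n). -/

import Mathlib

open Filter

/-- The fixed point sequence. -/
noncomputable def fpSeq : ℕ → ℝ
  | 0 => 1
  | n + 1 => (-1 + Real.sqrt (1 + 4 * fpSeq n ^ 2)) / (2 * fpSeq n)

theorem fpSeq_pos (n : ℕ) : 0 < fpSeq n := by
  induction n with
  | zero => simp [fpSeq]
  | succ n ih =>
    have hs : 1 < Real.sqrt (1 + 4 * fpSeq n ^ 2) := by
      rw [Real.lt_sqrt zero_le_one]
      nlinarith [pow_pos ih 2]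
    rw [fpSeq]
    exact div_pos (by linarith) (by linarith)

theorem fpSeq_succ_eq (n : ℕ) : fpSeq (n + 1) = fpSeq n * (1 - fpSeq (n + 1) ^ 2) := by
  have hpos := fpSeq_pos n
  have hs : Real.sqrt (1 + 4 * fpSeq n ^ 2) ^ 2 = 1 + 4 * fpSeq n ^ 2 :=
    Real.sq_sqrt (by positivity)
  have hy : 2 * fpSeq n * fpSeq (n + 1) = -1 + Real.sqrt (1 + 4 * fpSeq n ^ 2) := by
    rw [fpSeq]
    field_simp
  have hroot : (2 * fpSeq n * fpSeq (n + 1) + 1) ^ 2 = 1 + 4 * fpSeq n ^ 2 := by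
    rw [hy]
    linear_combination hs
  refine mul_left_cancel₀ (mul_pos four_pos hpos).ne' ?_
  linear_combination hroot

theorem fpSeq_succ_sq_lt_one (n : ℕ) : fpSeq (n + 1) ^ 2 < 1 := by
  have h := fpSeq_pos (n + 1)
  rw [fpSeq_succ_eq] at h
  linarith [pos_of_mul_pos_right h (fpSeq_pos n).le]

theorem inv_fpSeq_sq_succ_sub (n : ℕ) :
    (fpSeq (n + 1) ^ 2)⁻¹ - (fpSeq n ^ 2)⁻¹ = 2 - fpSeq (n + 1) ^ 2 := by
  have hy := (fpSeq_pos (n + 1)).ne'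
  have hx := (fpSeq_pos n).ne'
  have hinv : (fpSeq n)⁻¹ = (fpSeq (n + 1))⁻¹ - fpSeq (n + 1) := by
    field_simp
    linear_combination fpSeq_succ_eq n
  rw [← inv_pow, ← inv_pow, hinv]
  field_simp
  ring

theorem le_inv_fpSeq_sq (n : ℕ) : (n : ℝ) ≤ (fpSeq n ^ 2)⁻¹ := by
  induction n with
  | zero => simp [fpSeq]
  | succ n ih =>
    push_cast
    linarith [inv_fpSeq_sq_succ_sub n, fpSeq_succ_sq_lt_one n]

theorem tendsto_fpSeq_sq : Tendsto (fun n => fpSeq n ^ 2) atTop (nhds 0) := by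
  have h : Tendsto (fun n => (fpSeq n ^ 2)⁻¹) atTop atTop :=
    tendsto_atTop_mono le_inv_fpSeq_sq tendsto_natCast_atTop_atTop
  exact h.inv_tendsto_atTop.congr fun n => inv_inv _

theorem tendsto_inv_fpSeq_sq_div :
    Tendsto (fun n : ℕ => (n : ℝ)⁻¹ * (fpSeq n ^ 2)⁻¹) atTop (nhds 2) := by
  have hdiff : Tendsto (fun n => (fpSeq (n + 1) ^ 2)⁻¹ - (fpSeq n ^ 2)⁻¹) atTop (nhds 2) := by
    simp_rw [inv_fpSeq_sq_succ_sub]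
    simpa using ((tendsto_add_atTop_iff_nat 1).2 tendsto_fpSeq_sq).const_sub 2
  have hmean := hdiff.cesaro
  simp_rw [Finset.sum_range_sub (fun n => (fpSeq n ^ 2)⁻¹)] at hmean
  have hinv : Tendsto (fun n : ℕ => (n : ℝ)⁻¹) atTop (nhds 0) :=
    tendsto_inv_atTop_nhds_zero_nat
  simpa [fpSeq, mul_sub] using hmean.add hinv

theorem stmt_9 :
    Tendsto (fun n : ℕ => fpSeq n * Real.sqrt (2 * n)) atTop (nhds 1) := by
  have h := ((tendsto_inv_fpSeq_sq_div.inv₀ two_ne_zero).const_mul 2).sqrt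
  rw [mul_inv_cancel₀ two_ne_zero, Real.sqrt_one] at h
  refine h.congr fun n => ?_
  rw [mul_inv, inv_inv, inv_inv, ← mul_assoc, mul_comm, Real.sqrt_mul (sq_nonneg _),
    Real.sqrt_sq (fpSeq_pos n).le]
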